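/- Let a < b, let U : [a,b] → ℂ be continuously differentiable with U(a) = U(b), and let K be a positive integer. Then for every integer k with |k| ≤ K, |Û[k] − Û[k; 2K+1]| ≤ 6(b−a)‖U'‖_∞ / (π K). -/

import Mathlib

open Complex MeasureTheory

/-- The distance of `exp (iθ)` from `1` is comparable to `|θ|` for `|θ| ≤ π`. -/
lemma two_div_pi_mul_abs_le_norm_exp_I_sub_one {θ : ℝ} (hθ : |θ| ≤ Real.pi) :
    2 / Real.pi * |θ| ≤ ‖exp (I * (θ : ℂ)) - 1‖ := by
  have h2 : |θ / 2| = |θ| / 2 := by rw [abs_div, abs_two]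
  have h := Real.mul_abs_le_abs_sin (x := θ / 2) (by rw [h2]; linarith)
  rw [norm_exp_I_mul_ofReal_sub_one, norm_mul, Real.norm_two, Real.norm_eq_abs]
  rw [h2] at h
  linarith

lemma norm_exp_I_sub_exp_I_le (x y : ℝ) :
    ‖exp (I * (x : ℂ)) - exp (I * (y : ℂ))‖ ≤ |x - y| := by
  have h : exp (I * (x : ℂ)) - exp (I * (y : ℂ))
      = exp (I * (y : ℂ)) * (exp (I * ((x - y : ℝ) : ℂ)) - 1) := by
    rw [mul_sub, ← Complex.exp_add, mul_one]
    congr 2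
    push_cast
    ring
  rw [h, norm_mul, norm_exp_I_mul_ofReal, one_mul]
  exact Real.norm_exp_I_mul_ofReal_sub_one_le

/-- A primitive of `t ↦ exp (iωt)` whose boundary values on `[0, h]` make the boundary terms of an
integration by parts add up to a Riemann sum, together with a uniform bound of order `h`. -/
lemma exists_primitive_exp_bounded {ω h : ℝ} (hh : 0 < h) (hω : |ω * h| ≤ Real.pi) :
    ∃ ψ : ℝ → ℂ, (∀ t, HasDerivAt ψ (exp (I * ((ω * t : ℝ) : ℂ))) t) ∧
      ψ h = exp (I * ((ω * h : ℝ) : ℂ)) * (h + ψ 0) ∧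
      ∀ t ∈ Set.Icc 0 h, ‖ψ t‖ ≤ h * (1 + Real.pi / 2) := by
  have hc : Continuous fun t : ℝ => exp (I * ((ω * t : ℝ) : ℂ)) := by fun_prop
  set q := exp (I * ((ω * h : ℝ) : ℂ)) with hq
  set J := ∫ s in (0 : ℝ)..h, exp (I * ((ω * s : ℝ) : ℂ)) with hJ
  obtain ⟨d, hd, hdn⟩ : ∃ d : ℂ, J + d = q * (h + d) ∧ ‖d‖ ≤ h * (Real.pi / 2) := by
    rcases eq_or_ne ω 0 with rfl | hω0
    · exact ⟨0, by simp [hJ, hq], by simpa using by positivity⟩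
    have hpos : 0 < |ω * h| := abs_pos.2 (mul_ne_zero hω0 hh.ne')
    have hlow := two_div_pi_mul_abs_le_norm_exp_I_sub_one hω
    rw [← hq] at hlow
    have hlow' : 0 < 2 / Real.pi * |ω * h| := by positivity
    have hne : q - 1 ≠ 0 := norm_pos_iff.1 (hlow'.trans_le hlow)
    have hnum : ‖J - q * h‖ ≤ |ω * h| * h := by
      have hsub : J - q * h = ∫ s in (0 : ℝ)..h, (exp (I * ((ω * s : ℝ) : ℂ)) - q) := by
        rw [intervalIntegral.integral_sub (hc.intervalIntegrable _ _)
          intervalIntegrable_const, intervalIntegral.integral_const]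
        simp [hJ, mul_comm]
      rw [hsub]
      have hb : ∀ s ∈ Set.uIoc 0 h, ‖exp (I * ((ω * s : ℝ) : ℂ)) - q‖ ≤ |ω * h| := by
        intro s hs
        rw [Set.uIoc_of_le hh.le] at hs
        refine (norm_exp_I_sub_exp_I_le _ _).trans ?_
        rw [← mul_sub, abs_mul, abs_mul]
        refine mul_le_mul_of_nonneg_left ?_ (abs_nonneg ω)
        rw [abs_le, abs_of_pos hh]
        constructor <;> linarith [hs.1, hs.2]
      simpa [abs_of_pos hh] using intervalIntegral.norm_integral_le_of_norm_le_const hb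
    refine ⟨(J - q * h) / (q - 1), by field_simp; ring, ?_⟩
    rw [norm_div, div_le_iff₀ (norm_pos_iff.2 hne)]
    calc ‖J - q * h‖ ≤ |ω * h| * h := hnum
      _ = h * (Real.pi / 2) * (2 / Real.pi * |ω * h|) := by field_simp
      _ ≤ _ := by gcongr
  refine ⟨fun t => (∫ s in (0 : ℝ)..t, exp (I * ((ω * s : ℝ) : ℂ))) + d, fun t => ?_, ?_, ?_⟩
  · exact (hc.integral_hasStrictDerivAt 0 t).hasDerivAt.add_const d
  · simp only [intervalIntegral.integral_same, zero_add]
    exact hd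
  · intro t ht
    have hint : ‖∫ s in (0 : ℝ)..t, exp (I * ((ω * s : ℝ) : ℂ))‖ ≤ 1 * |t - 0| :=
      intervalIntegral.norm_integral_le_of_norm_le_const fun s _ =>
        (norm_exp_I_mul_ofReal _).le
    rw [sub_zero, abs_of_nonneg ht.1] at hint
    calc _ ≤ _ := norm_add_le _ _
      _ ≤ h * (1 + Real.pi / 2) := by linarith [ht.2]

/-- Integration by parts on one cell, against a primitive of `exp (iωx)`. -/
lemma norm_integral_mul_exp_sub_le {u v ω M C : ℝ} (huv : u ≤ v) {U U' ψ : ℝ → ℂ}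
    (hU : ∀ x ∈ Set.Icc u v, HasDerivWithinAt U (U' x) (Set.Icc u v) x)
    (hU' : ContinuousOn U' (Set.Icc u v)) (hM : ∀ x ∈ Set.Icc u v, ‖U' x‖ ≤ M)
    (hψ : ∀ t, HasDerivAt ψ (exp (I * ((ω * t : ℝ) : ℂ))) t)
    (hC : ∀ t ∈ Set.Icc 0 (v - u), ‖ψ t‖ ≤ C) :
    ‖(∫ x in u..v, U x * exp (I * ((ω * x : ℝ) : ℂ)))
      - exp (I * ((ω * u : ℝ) : ℂ)) * (U v * ψ (v - u) - U u * ψ 0)‖ ≤ M * C * (v - u) := by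
  set e := exp (I * ((ω * u : ℝ) : ℂ)) with he
  have hderiv : ∀ x, HasDerivAt (fun x => e * ψ (x - u)) (exp (I * ((ω * x : ℝ) : ℂ))) x := by
    intro x
    have h := ((hψ (x - u)).comp_sub_const x u).const_mul e
    have hexp : e * exp (I * ((ω * (x - u) : ℝ) : ℂ)) = exp (I * ((ω * x : ℝ) : ℂ)) := by
      rw [he, ← Complex.exp_add]
      congr 1
      push_cast
      ring
    rwa [hexp] at h
  have hparts := intervalIntegral.integral_mul_deriv_eq_deriv_mul_of_hasDerivWithinAt
    (a := u) (b := v) (u := U) (u' := U') (v := fun x => e * ψ (x - u))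
    (v' := fun x => exp (I * ((ω * x : ℝ) : ℂ)))
    (by rwa [Set.uIcc_of_le huv]) (fun x _ => (hderiv x).hasDerivWithinAt)
    (by rw [← Set.uIcc_of_le huv] at hU'; exact hU'.intervalIntegrable)
    (Continuous.intervalIntegrable (by fun_prop) _ _)
  have hrest : (∫ x in u..v, U x * exp (I * ((ω * x : ℝ) : ℂ)))
      - e * (U v * ψ (v - u) - U u * ψ 0) = -∫ x in u..v, U' x * (e * ψ (x - u)) := by
    rw [hparts, sub_self]
    ring
  rw [hrest, norm_neg]
  refine (intervalIntegral.norm_integral_le_of_norm_le_const (C := M * C) fun x hx => ?_).trans_eq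
    (by rw [abs_of_nonneg (sub_nonneg.2 huv)])
  rw [Set.uIoc_of_le huv] at hx
  have hM' := hM x ⟨hx.1.le, hx.2⟩
  rw [norm_mul, norm_mul, he, norm_exp_I_mul_ofReal, one_mul]
  exact mul_le_mul hM' (hC _ ⟨by linarith [hx.1], by linarith [hx.2]⟩) (norm_nonneg _)
    ((norm_nonneg _).trans hM')

/-- Error of the composite rectangle rule for `U x * exp (iωx)` on a uniform grid of mesh `h`, when
the integrand takes the same value at both ends. -/
lemma norm_integral_mul_exp_sub_sum_le {a h ω M : ℝ} (hh : 0 < h) (hω : |ω * h| ≤ Real.pi)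
    {L : ℕ} {U U' : ℝ → ℂ}
    (hU : ∀ x ∈ Set.Icc a (a + L * h), HasDerivWithinAt U (U' x) (Set.Icc a (a + L * h)) x)
    (hU' : ContinuousOn U' (Set.Icc a (a + L * h)))
    (hM : ∀ x ∈ Set.Icc a (a + L * h), ‖U' x‖ ≤ M)
    (hper : U (a + L * h) * exp (I * ((ω * (a + L * h) : ℝ) : ℂ))
      = U a * exp (I * ((ω * a : ℝ) : ℂ))) :
    ‖(∫ x in a..(a + L * h), U x * exp (I * ((ω * x : ℝ) : ℂ)))
      - h * ∑ i ∈ Finset.range L, U (a + i * h) * exp (I * ((ω * (a + i * h) : ℝ) : ℂ))‖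
      ≤ M * (h * (1 + Real.pi / 2)) * (L * h) := by
  obtain ⟨ψ, hψ, hψh, hψC⟩ := exists_primitive_exp_bounded hh hω
  have hstep : ∀ j : ℕ, a + ((j + 1 : ℕ) : ℝ) * h - (a + j * h) = h := by
    intro j; push_cast; ring
  have hsub : ∀ j < L, Set.Icc (a + j * h) (a + ((j + 1 : ℕ) : ℝ) * h)
      ⊆ Set.Icc a (a + L * h) := by
    intro j hj
    have hjL : ((j + 1 : ℕ) : ℝ) ≤ L := by exact_mod_cast hj
    refine Set.Icc_subset_Icc (le_add_of_nonneg_right (by positivity)) ?_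
    gcongr
  set F : ℕ → ℂ := fun j => U (a + j * h) * exp (I * ((ω * (a + j * h) : ℝ) : ℂ)) with hF
  have hint : (∫ x in a..(a + L * h), U x * exp (I * ((ω * x : ℝ) : ℂ)))
      = ∑ j ∈ Finset.range L, ∫ x in (a + j * h)..(a + ((j + 1 : ℕ) : ℝ) * h),
          U x * exp (I * ((ω * x : ℝ) : ℂ)) := by
    rw [intervalIntegral.sum_integral_adjacent_intervals (a := fun j : ℕ => a + j * h)]
    · simp
    intro j hj
    have hle : a + j * h ≤ a + ((j + 1 : ℕ) : ℝ) * h := by linarith [hstep j]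
    refine ContinuousOn.intervalIntegrable ?_
    rw [Set.uIcc_of_le hle]
    have hUc : ContinuousOn U (Set.Icc a (a + L * h)) :=
      fun x hx => (hU x hx).continuousWithinAt
    exact (hUc.mono (hsub j hj)).mul (Continuous.continuousOn (by fun_prop))
  have hsum : (h : ℂ) * ∑ j ∈ Finset.range L, F j
      = ∑ j ∈ Finset.range L, (F (j + 1) * (h + ψ 0) - F j * ψ 0) := by
    have h1 := Finset.sum_range_sub F L
    have h2 : F L - F 0 = 0 := by
      simp only [hF, hper, Nat.cast_zero, zero_mul, add_zero, sub_self]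
    rw [h2] at h1
    have h3 : ∑ j ∈ Finset.range L, (F (j + 1) * (h + ψ 0) - F j * ψ 0)
        = (∑ j ∈ Finset.range L, (F (j + 1) - F j)) * (h + ψ 0)
          + (∑ j ∈ Finset.range L, F j) * h := by
      rw [Finset.sum_mul, Finset.sum_mul, ← Finset.sum_add_distrib]
      exact Finset.sum_congr rfl fun j _ => by ring
    rw [h3, h1]
    ring
  rw [hint, hsum, ← Finset.sum_sub_distrib]
  have hcell : ∀ j ∈ Finset.range L,
      ‖(∫ x in (a + j * h)..(a + ((j + 1 : ℕ) : ℝ) * h), U x * exp (I * ((ω * x : ℝ) : ℂ)))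
        - (F (j + 1) * (h + ψ 0) - F j * ψ 0)‖ ≤ M * (h * (1 + Real.pi / 2)) * h := by
    intro j hj
    have hs := hsub j (Finset.mem_range.1 hj)
    have hmain := norm_integral_mul_exp_sub_le (by linarith [hstep j])
      (fun x hx => (hU x (hs hx)).mono hs) (hU'.mono hs) (fun x hx => hM x (hs hx)) hψ
      (by rwa [hstep j])
    rw [hstep j] at hmain
    convert hmain using 3
    have hexp : exp (I * ((ω * (a + ((j + 1 : ℕ) : ℝ) * h) : ℝ) : ℂ))
        = exp (I * ((ω * (a + j * h) : ℝ) : ℂ)) * exp (I * ((ω * h : ℝ) : ℂ)) := by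
      rw [← Complex.exp_add]
      congr 1
      push_cast
      ring
    simp only [hF]
    rw [hexp, hψh]
    ring
  refine (norm_sum_le_of_le _ hcell).trans_eq ?_
  rw [Finset.sum_const, Finset.card_range, nsmul_eq_mul]
  ring

/-- for a C¹ function `U` on `[a,b]` with `U a = U b`, with derivative `U'`
bounded by `M` on `[a,b]`, for all `|k| ≤ K` the finite Fourier coefficient on the
uniform grid of size `2K+1` approximates the Fourier coefficient with error at most
`6(b-a)M/(πK)`. -/
theorem finite_fourier_coeff_error_bound
    (a b : ℝ) (hab : a < b) (U U' : ℝ → ℂ)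
    (hderiv : ∀ x ∈ Set.Icc a b, HasDerivWithinAt U (U' x) (Set.Icc a b) x)
    (hcont : ContinuousOn U' (Set.Icc a b))
    (hper : U a = U b)
    (M : ℝ) (hM : ∀ x ∈ Set.Icc a b, ‖U' x‖ ≤ M)
    (K : ℕ) (hK : 0 < K) (k : ℤ) (hk : |k| ≤ (K : ℤ)) :
    ‖(1 / ((b : ℂ) - a)) * (∫ x in a..b,
          U x * (starRingEnd ℂ) (Complex.exp (2 * Real.pi * Complex.I * (k : ℂ) * (x : ℂ) /
            ((b : ℂ) - a))))
      - (1 / ((2 * K + 1 : ℕ) : ℂ)) * ∑ i : Fin (2 * K + 1),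
          U (a + (i : ℝ) * (b - a) / (2 * K + 1)) *
            (starRingEnd ℂ) (Complex.exp (2 * Real.pi * Complex.I * (k : ℂ) *
              ((a : ℂ) + (i : ℂ) * ((b : ℂ) - a) / ((2 * K + 1 : ℕ) : ℂ)) / ((b : ℂ) - a)))‖
      ≤ 6 * (b - a) * M / (Real.pi * K) := by
  have hba : 0 < b - a := sub_pos.2 hab
  have hbaC : (b : ℂ) - a ≠ 0 := by exact_mod_cast hba.ne'
  have hK' : (0 : ℝ) < K := by exact_mod_cast hK
  have hM0 : 0 ≤ M := (norm_nonneg _).trans (hM a ⟨le_rfl, hab.le⟩)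
  set L : ℕ := 2 * K + 1 with hL
  have hLR : (L : ℝ) = 2 * K + 1 := by rw [hL]; push_cast; ring
  have hLpos : (0 : ℝ) < L := by rw [hLR]; positivity
  set h : ℝ := (b - a) / L with hh
  have hhpos : 0 < h := div_pos hba hLpos
  set ω : ℝ := -(2 * Real.pi * k / (b - a)) with hωdef
  have hb : a + L * h = b := by rw [hh]; field_simp; ring
  have hω : |ω * h| ≤ Real.pi := by
    have hkR : |(k : ℝ)| ≤ K := by exact_mod_cast hk
    have h1 : ω * h = -(2 * Real.pi * k / L) := by rw [hωdef, hh]; field_simp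
    rw [h1, abs_neg, abs_div, abs_mul, abs_of_pos Real.two_pi_pos, abs_of_pos hLpos,
      div_le_iff₀ hLpos, hLR]
    nlinarith [Real.pi_pos]
  have hconj : ∀ z : ℝ, (starRingEnd ℂ) (exp (2 * Real.pi * I * (k : ℂ) * (z : ℂ) /
      ((b : ℂ) - a))) = exp (I * ((ω * z : ℝ) : ℂ)) := by
    intro z
    rw [← Complex.exp_conj]
    congr 1
    simp only [hωdef, map_div₀, map_mul, map_sub, conj_ofReal, conj_I, map_ofNat, map_intCast]
    push_cast
    ring
  have hexp : exp (I * ((ω * b : ℝ) : ℂ)) = exp (I * ((ω * a : ℝ) : ℂ)) := by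
    rw [Complex.exp_eq_exp_iff_exists_int]
    refine ⟨-k, ?_⟩
    rw [hωdef]
    push_cast
    field_simp
    ring
  have hmain := norm_integral_mul_exp_sub_sum_le (a := a) (L := L) (U := U) (U' := U') (M := M)
    hhpos hω (by rwa [hb]) (by rwa [hb]) (by rwa [hb]) (by rw [hb, hexp, hper])
  rw [hb] at hmain
  have hsum : ∑ i : Fin L, U (a + (i : ℝ) * (b - a) / (2 * K + 1)) *
            (starRingEnd ℂ) (exp (2 * Real.pi * I * (k : ℂ) *
              ((a : ℂ) + (i : ℂ) * ((b : ℂ) - a) / (L : ℂ)) / ((b : ℂ) - a)))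
      = ∑ i ∈ Finset.range L, U (a + i * h) * exp (I * ((ω * (a + i * h) : ℝ) : ℂ)) := by
    rw [← Fin.sum_univ_eq_sum_range
      (fun i : ℕ => U (a + i * h) * exp (I * ((ω * (a + i * h) : ℝ) : ℂ)))]
    refine Finset.sum_congr rfl fun i _ => ?_
    rw [← hconj, ← hLR, hh, mul_div_assoc]
    push_cast
    rw [mul_div_assoc ((i : ℕ) : ℂ)]
  rw [hsum]
  simp_rw [hconj]
  have hfactor : ∀ A S : ℂ, 1 / ((b : ℂ) - a) * A - 1 / (L : ℂ) * S
      = ((1 / (b - a) : ℝ) : ℂ) * (A - h * S) := by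
    intro A S
    rw [hh]
    push_cast
    field_simp
  rw [hfactor, norm_mul, Complex.norm_of_nonneg (by positivity)]
  have hLh : (L : ℝ) * h = b - a := by linarith
  rw [hLh] at hmain
  calc _ ≤ 1 / (b - a) * (M * (h * (1 + Real.pi / 2)) * (b - a)) := by gcongr
    _ = (b - a) * M * ((1 + Real.pi / 2) / L) := by rw [hh]; field_simp
    _ ≤ (b - a) * M * (6 / (Real.pi * K)) := by
      refine mul_le_mul_of_nonneg_left ?_ (by positivity)
      rw [div_le_div_iff₀ hLpos (by positivity), hLR]
      have hp : Real.pi * (1 + Real.pi / 2) ≤ 12 := by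
        nlinarith [Real.pi_pos, Real.pi_lt_d2]
      nlinarith
    _ = _ := by ring
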